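/- Let n, p ≥ 1 and k ≥ 1. The complete bipartite graph K_{n,p} is Z_{2^k}-AW if and only if at least one of n and p is even. -/

import Mathlib

-- Toggling a vertex `v` in the `ZMod m`-labeling lights out game:
-- the label of `v` is added to the labels of `v` and all its neighbors.
open Classical in
noncomputable def gToggle {V : Type*} (G : SimpleGraph V) {m : ℕ} (v : V)
    (lab : V → ZMod m) : V → ZMod m :=
  fun w => if w = v ∨ G.Adj v w then lab v + lab w else lab w

/-- The result of toggling, in order, the vertices in the list `L`
in the `ZMod m`-labeling lights out game. -/
noncomputable def gPlay {V : Type*} (G : SimpleGraph V) {m : ℕ} (L : List V)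
    (lab : V → ZMod m) : V → ZMod m :=
  L.foldl (fun l v => gToggle G v l) lab

/-- A labeling is winnable in the `ZMod m`-labeling lights out game if some
finite sequence of toggles transforms it into the zero labeling. -/
def gWinnable {V : Type*} (G : SimpleGraph V) {m : ℕ} (lab : V → ZMod m) : Prop :=
  ∃ L : List V, gPlay G L lab = 0

/-- `G` is `ZMod m`-Always Winnable: every labeling is winnable
in the `ZMod m`-labeling lights out game. -/
def gAW {V : Type*} (G : SimpleGraph V) (m : ℕ) : Prop :=
  ∀ lab : V → ZMod m, gWinnable G lab

-- Toggling a vertex `v` in the neighborhood `m`-lights out game: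
-- the labels of `v` and all its neighbors are increased by `1`.
open Classical in
noncomputable def nToggle {V : Type*} (G : SimpleGraph V) {m : ℕ} (v : V)
    (lab : V → ZMod m) : V → ZMod m :=
  fun w => if w = v ∨ G.Adj v w then lab w + 1 else lab w

/-- The result of toggling, in order, the vertices in the list `L`
in the neighborhood `m`-lights out game. -/
noncomputable def nPlay {V : Type*} (G : SimpleGraph V) {m : ℕ} (L : List V)
    (lab : V → ZMod m) : V → ZMod m :=
  L.foldl (fun l v => nToggle G v l) lab

/-- A labeling is `(N,m)`-winnable if some finite sequence of toggles in the
neighborhood `m`-lights out game transforms it into the zero labeling. -/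
def nWinnable {V : Type*} (G : SimpleGraph V) {m : ℕ} (lab : V → ZMod m) : Prop :=
  ∃ L : List V, nPlay G L lab = 0

/-- `G` is `(N,m)`-Always Winnable: every labeling is winnable
in the neighborhood `m`-lights out game. -/
def nAW {V : Type*} (G : SimpleGraph V) (m : ℕ) : Prop :=
  ∀ lab : V → ZMod m, nWinnable G lab

/-- The parity of an element of `ZMod n`, as an element of `ZMod 2`:
`1` if its representatives are odd, `0` if they are even. -/
def parity {n : ℕ} (x : ZMod n) : ZMod 2 :=
  if x.val % 2 = 1 then 1 else 0

open scoped Classical in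
theorem gToggle_apply {V : Type*} (G : SimpleGraph V) {m : ℕ} (v : V) (lab : V → ZMod m) (w : V) :
    gToggle G v lab w = lab w + if w = v ∨ G.Adj v w then lab v else 0 := by
  unfold gToggle
  split_ifs <;> ring

theorem gPlay_append {V : Type*} (G : SimpleGraph V) {m : ℕ} (L₁ L₂ : List V)
    (lab : V → ZMod m) : gPlay G (L₁ ++ L₂) lab = gPlay G L₂ (gPlay G L₁ lab) :=
  List.foldl_append

open scoped Classical in
/-- Toggling the vertices of an independent list once each adds to every label the original labels
of the toggled vertices in its closed neighborhood. -/
theorem gPlay_apply_of_pairwise {V : Type*} (G : SimpleGraph V) {m : ℕ} (L : List V)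
    (hL : L.Pairwise fun v w => w ≠ v ∧ ¬ G.Adj v w) (lab : V → ZMod m) (w : V) :
    gPlay G L lab w =
      lab w + (L.map fun v => if w = v ∨ G.Adj v w then lab v else 0).sum := by
  induction L generalizing lab with
  | nil => simp [gPlay]
  | cons v L ih =>
    rw [List.pairwise_cons] at hL
    have h : (L.map fun u => if w = u ∨ G.Adj u w then gToggle G v lab u else 0)
        = L.map fun u => if w = u ∨ G.Adj u w then lab u else 0 := by
      refine List.map_congr_left fun u hu => ?_
      rw [gToggle_apply G v lab u, if_neg (not_or.mpr (hL.1 u hu)), add_zero]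
    change gPlay G L (gToggle G v lab) w = _
    rw [ih hL.2, h, gToggle_apply, List.map_cons, List.sum_cons, add_assoc]

section CompleteBipartite

variable {n p m : ℕ}

/-- Toggling every vertex of the left part of a complete bipartite graph once. -/
theorem gPlay_left (lab : Fin n ⊕ Fin p → ZMod m) :
    gPlay (completeBipartiteGraph (Fin n) (Fin p)) ((List.finRange n).map Sum.inl) lab =
      Sum.elim (fun i => 2 * lab (Sum.inl i))
        (fun j => lab (Sum.inr j) + ∑ i, lab (Sum.inl i)) := by
  classical
  funext w
  rw [gPlay_apply_of_pairwise]
  · rw [List.map_map, ← Fin.sum_univ_def]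
    cases w <;> simp [two_mul]
  · rw [List.pairwise_map]
    exact (List.nodup_finRange n).imp fun h => by simpa using Ne.symm h

/-- Toggling every vertex of the right part of a complete bipartite graph once. -/
theorem gPlay_right (lab : Fin n ⊕ Fin p → ZMod m) :
    gPlay (completeBipartiteGraph (Fin n) (Fin p)) ((List.finRange p).map Sum.inr) lab =
      Sum.elim (fun i => lab (Sum.inl i) + ∑ j, lab (Sum.inr j))
        (fun j => 2 * lab (Sum.inr j)) := by
  classical
  funext w
  rw [gPlay_apply_of_pairwise]
  · rw [List.map_map, ← Fin.sum_univ_def]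
    cases w <;> simp [two_mul]
  · rw [List.pairwise_map]
    exact (List.nodup_finRange p).imp fun h => by simpa using Ne.symm h

/-- If one part has even size, a common divisor of all labels can be doubled. -/
theorem exists_gPlay_dvd (h : Even (n * p)) (c : ZMod m) (lab : Fin n ⊕ Fin p → ZMod m)
    (hc : ∀ w, c ∣ lab w) :
    ∃ L, ∀ w, c * 2 ∣ gPlay (completeBipartiteGraph (Fin n) (Fin p)) L lab w := by
  choose μ hμ using hc
  obtain ⟨t, ht⟩ := h
  have ht' : (n : ZMod m) * p = t + t := by exact_mod_cast congrArg (Nat.cast : ℕ → ZMod m) ht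
  refine ⟨(List.finRange p).map Sum.inr ++ ((List.finRange n).map Sum.inl ++
    ((List.finRange p).map Sum.inr ++ (List.finRange n).map Sum.inl)), fun w => ?_⟩
  simp only [gPlay_append, gPlay_left, gPlay_right, hμ]
  cases w with
  | inl i =>
    simp only [Sum.elim_inl, Sum.elim_inr, Finset.sum_add_distrib, Finset.sum_const,
      Finset.card_univ, Fintype.card_fin, nsmul_eq_mul, ← Finset.mul_sum]
    generalize ∑ i, μ (Sum.inl i) = a
    generalize ∑ j, μ (Sum.inr j) = b
    refine ⟨2 * (μ (Sum.inl i) + b) + 2 * b + p * (a + n * b), ?_⟩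
    ring
  | inr j =>
    simp only [Sum.elim_inl, Sum.elim_inr, Finset.sum_add_distrib, Finset.sum_const,
      Finset.card_univ, Fintype.card_fin, nsmul_eq_mul, ← Finset.mul_sum]
    generalize ∑ i, μ (Sum.inl i) = a
    generalize ∑ j, μ (Sum.inr j) = b
    refine ⟨2 * μ (Sum.inr j) + 2 * (a + n * b) + n * b + t * (a + n * b), ?_⟩
    linear_combination (c * (a + n * b)) * ht'

theorem gAW_completeBipartiteGraph_two_pow (h : Even (n * p)) (k : ℕ) :
    gAW (completeBipartiteGraph (Fin n) (Fin p)) (2 ^ k) := by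
  intro lab
  have key : ∀ j : ℕ, ∃ L, ∀ w, (2 : ZMod (2 ^ k)) ^ j ∣
      gPlay (completeBipartiteGraph (Fin n) (Fin p)) L lab w := by
    intro j
    induction j with
    | zero => exact ⟨[], fun w => by simp⟩
    | succ j ih =>
      obtain ⟨L, hL⟩ := ih
      obtain ⟨L', hL'⟩ := exists_gPlay_dvd h _ _ hL
      exact ⟨L ++ L', fun w => by rw [gPlay_append, pow_succ]; exact hL' w⟩
  obtain ⟨L, hL⟩ := key k
  have h0 : (2 : ZMod (2 ^ k)) ^ k = 0 := by exact_mod_cast ZMod.natCast_self (2 ^ k)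
  exact ⟨L, funext fun w => by simpa [h0] using hL w⟩

/-- If both parts have odd size, every toggle preserves the parity of the sum of the labels. -/
theorem sum_map_gToggle (f : ZMod m →+* ZMod 2) (hn : Odd n) (hp : Odd p) (v : Fin n ⊕ Fin p)
    (lab : Fin n ⊕ Fin p → ZMod m) :
    ∑ w, f (gToggle (completeBipartiteGraph (Fin n) (Fin p)) v lab w) = ∑ w, f (lab w) := by
  classical
  have hn' : (n : ZMod 2) = 1 := ZMod.natCast_eq_one_iff_odd.mpr hn
  have hp' : (p : ZMod 2) = 1 := ZMod.natCast_eq_one_iff_odd.mpr hp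
  simp only [gToggle_apply, map_add, Finset.sum_add_distrib, apply_ite f, map_zero]
  rw [add_eq_left]
  cases v <;> simp [hn', hp', CharTwo.add_self_eq_zero]

theorem sum_map_gPlay (f : ZMod m →+* ZMod 2) (hn : Odd n) (hp : Odd p)
    (L : List (Fin n ⊕ Fin p)) (lab : Fin n ⊕ Fin p → ZMod m) :
    ∑ w, f (gPlay (completeBipartiteGraph (Fin n) (Fin p)) L lab w) = ∑ w, f (lab w) := by
  induction L generalizing lab with
  | nil => rfl
  | cons v L ih => exact (ih _).trans (sum_map_gToggle f hn hp v lab)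

theorem not_gAW_completeBipartiteGraph (hm : 2 ∣ m) (hn : Odd n) (hp : Odd p) :
    ¬ gAW (completeBipartiteGraph (Fin n) (Fin p)) m := by
  classical
  intro h
  let v : Fin n ⊕ Fin p := Sum.inl ⟨0, hn.pos⟩
  obtain ⟨L, hL⟩ := h (Pi.single v 1)
  have hsum := sum_map_gPlay (ZMod.castHom hm (ZMod 2)) hn hp L (Pi.single v 1)
  rw [hL, ← map_sum, ← map_sum, Fintype.sum_pi_single', map_one] at hsum
  simp at hsum

end CompleteBipartite

theorem stmt19 (n p k : ℕ) (hn : 1 ≤ n) (hp : 1 ≤ p) (hk : 1 ≤ k) :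
    gAW (completeBipartiteGraph (Fin n) (Fin p)) (2 ^ k) ↔ (Even n ∨ Even p) := by
  rw [← Nat.even_mul]
  refine ⟨fun h => ?_, fun h => gAW_completeBipartiteGraph_two_pow h k⟩
  by_contra hodd
  rw [Nat.not_even_iff_odd, Nat.odd_mul] at hodd
  exact not_gAW_completeBipartiteGraph (dvd_pow_self 2 (by lia)) hodd.1 hodd.2 h
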